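/- Let k ≥ 6 be an integer and set q = 2^{−k}. Then for every nonempty ETR-C(q) instance φ there exists a nonempty ETR-INV instance ψ such that UNSAT(ψ) ≤ UNSAT(φ) and, for every d ∈ ℕ, (1266 + 2k)^{−1}·UNSAT_d(φ) ≤ UNSAT_d(ψ). -/

import Mathlib

open scoped Classical

/-- An ETR-INV constraint over a variable set `V`: `x = 1`, `x·y = 1`, or `x + y = z`. -/
inductive EtrInv (V : Type) : Type where
  | one : V → EtrInv V
  | inv : V → V → EtrInv V
  | add : V → V → V → EtrInv V

/-- Satisfaction of an ETR-INV constraint by an assignment `f`. -/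
def EtrInv.Sat {V : Type} (f : V → ℝ) : EtrInv V → Prop
  | .one x => f x = 1
  | .inv x y => f x * f y = 1
  | .add x y z => f x + f y = f z

/-- An ETR-C(q) constraint over a variable set `V`: `x = y`, `x = (1+q)·y`,
`x + y = z`, `x + y = z + w`, `x·y = z`, or `x·y = z·w`. -/
inductive EtrC (V : Type) : Type where
  | eq : V → V → EtrC V
  | eqQ : V → V → EtrC V
  | add : V → V → V → EtrC V
  | add4 : V → V → V → V → EtrC V
  | mul : V → V → V → EtrC V
  | mul4 : V → V → V → V → EtrC V

/-- Satisfaction of an ETR-C(q) constraint by an assignment `f`. -/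
def EtrC.Sat {V : Type} (q : ℝ) (f : V → ℝ) : EtrC V → Prop
  | .eq x y => f x = f y
  | .eqQ x y => f x = (1 + q) * f y
  | .add x y z => f x + f y = f z
  | .add4 x y z w => f x + f y = f z + f w
  | .mul x y z => f x * f y = f z
  | .mul4 x y z w => f x * f y = f z * f w

/-- `𝒜(d)`: the subfield of `ℝ` generated by all real roots of nonzero
integer-coefficient polynomials of degree at most `d`. -/
noncomputable def lowDegreeField (d : ℕ) : Subfield ℝ :=
  Subfield.closure {x : ℝ | ∃ p : Polynomial ℤ, p ≠ 0 ∧ p.natDegree ≤ d ∧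
    Polynomial.aeval x p = 0}

/-- `UNSAT` of an ETR-INV instance: the minimum over assignments `f : V → [1/2, 2]` of
the fraction of unsatisfied constraints. -/
noncomputable def unsatInv {n : ℕ} (ψ : Multiset (EtrInv (Fin n))) : ℝ :=
  sInf {u : ℝ | ∃ f : Fin n → ℝ, (∀ v, f v ∈ Set.Icc (1/2 : ℝ) 2) ∧
    u = ((ψ.filter (fun c => ¬ EtrInv.Sat f c)).card : ℝ) / (Multiset.card ψ : ℝ)}

/-- `UNSAT_d` of an ETR-INV instance: the minimum over assignments
`f : V → 𝒜(d) ∩ [1/2, 2]` of the fraction of unsatisfied constraints. -/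
noncomputable def unsatInvD (d : ℕ) {n : ℕ} (ψ : Multiset (EtrInv (Fin n))) : ℝ :=
  sInf {u : ℝ | ∃ f : Fin n → ℝ,
    (∀ v, f v ∈ Set.Icc (1/2 : ℝ) 2 ∧ f v ∈ lowDegreeField d) ∧
    u = ((ψ.filter (fun c => ¬ EtrInv.Sat f c)).card : ℝ) / (Multiset.card ψ : ℝ)}

/-- `UNSAT` of an ETR-C(q) instance: the minimum over assignments `f : V → [1/2, 2]` of
the fraction of unsatisfied constraints. -/
noncomputable def unsatC (q : ℝ) {n : ℕ} (φ : Multiset (EtrC (Fin n))) : ℝ :=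
  sInf {u : ℝ | ∃ f : Fin n → ℝ, (∀ v, f v ∈ Set.Icc (1/2 : ℝ) 2) ∧
    u = ((φ.filter (fun c => ¬ EtrC.Sat q f c)).card : ℝ) / (Multiset.card φ : ℝ)}

/-- `UNSAT_d` of an ETR-C(q) instance: the minimum over assignments
`f : V → 𝒜(d) ∩ [1/2, 2]` of the fraction of unsatisfied constraints. -/
noncomputable def unsatCD (q : ℝ) (d : ℕ) {n : ℕ} (φ : Multiset (EtrC (Fin n))) : ℝ :=
  sInf {u : ℝ | ∃ f : Fin n → ℝ,
    (∀ v, f v ∈ Set.Icc (1/2 : ℝ) 2 ∧ f v ∈ lowDegreeField d) ∧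
    u = ((φ.filter (fun c => ¬ EtrC.Sat q f c)).card : ℝ) / (Multiset.card φ : ℝ)}

/-- The range `[1/2, 2]` of all assignments. -/
abbrev InvRange : Set ℝ := Set.Icc (1/2 : ℝ) 2

/-- Renaming the variables of an ETR-INV constraint. -/
def EtrInv.map {V W : Type} (e : V → W) : EtrInv V → EtrInv W
  | .one x => .one (e x)
  | .inv x y => .inv (e x) (e y)
  | .add x y z => .add (e x) (e y) (e z)

theorem EtrInv.sat_map {V W : Type} (e : V → W) (f : W → ℝ) (c : EtrInv V) :
    (c.map e).Sat f ↔ c.Sat (f ∘ e) := by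
  cases c <;> rfl

/-- A relation on assignments of `W` is definable with `s` constraints if it is the projection of
an ETR-INV instance with `s` constraints and finitely many auxiliary variables. -/
def InvDefinable {W : Type} (s : ℕ) (R : (W → ℝ) → Prop) : Prop :=
  ∃ (A : Type) (_ : Finite A) (L : List (EtrInv (W ⊕ A))), L.length = s ∧
    ∀ w : W → ℝ, (∀ i, w i ∈ InvRange) →
      (R w ↔ ∃ h : A → ℝ, (∀ j, h j ∈ InvRange) ∧ ∀ c ∈ L, c.Sat (Sum.elim w h))

namespace InvDefinable

variable {W : Type} {s t : ℕ} {R T : (W → ℝ) → Prop}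

theorem congr (hR : InvDefinable s R) (h : ∀ w : W → ℝ, (∀ i, w i ∈ InvRange) → (R w ↔ T w)) :
    InvDefinable s T := by
  obtain ⟨A, hA, L, hL, H⟩ := hR
  exact ⟨A, hA, L, hL, fun w hw => (h w hw).symm.trans (H w hw)⟩

theorem constraint (c : EtrInv W) : InvDefinable 1 (fun w => c.Sat w) := by
  refine ⟨Empty, inferInstance, [c.map Sum.inl], rfl, fun w _ => ?_⟩
  simp [EtrInv.sat_map]

theorem one (i : W) : InvDefinable 1 (fun w => w i = 1) := constraint (.one i)

theorem inv (i j : W) : InvDefinable 1 (fun w => w i * w j = 1) := constraint (.inv i j)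

theorem add (i j k : W) : InvDefinable 1 (fun w => w i + w j = w k) := constraint (.add i j k)

theorem trivial (W : Type) (s : ℕ) : InvDefinable s (fun _ : W → ℝ => True) := by
  refine ⟨Unit, inferInstance, List.replicate s (.one (Sum.inr ())), by simp, fun w _ => ?_⟩
  refine iff_of_true _root_.trivial ⟨fun _ => 1, fun _ => by norm_num [InvRange], fun c hc => ?_⟩
  rw [List.eq_of_mem_replicate hc]
  rfl

theorem and (hR : InvDefinable s R) (hT : InvDefinable t T) :
    InvDefinable (s + t) (fun w => R w ∧ T w) := by
  obtain ⟨A, hA, L, rfl, H⟩ := hR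
  obtain ⟨B, hB, M, rfl, K⟩ := hT
  refine ⟨A ⊕ B, inferInstance, L.map (EtrInv.map (Sum.map id Sum.inl)) ++
    M.map (EtrInv.map (Sum.map id Sum.inr)), by simp, fun w hw => ?_⟩
  have e₁ : ∀ h : A ⊕ B → ℝ,
      Sum.elim w h ∘ Sum.map id Sum.inl = Sum.elim w (h ∘ Sum.inl) := fun h => by
    ext x; cases x <;> rfl
  have e₂ : ∀ h : A ⊕ B → ℝ,
      Sum.elim w h ∘ Sum.map id Sum.inr = Sum.elim w (h ∘ Sum.inr) := fun h => by
    ext x; cases x <;> rfl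
  refine (and_congr (H w hw) (K w hw)).trans ?_
  constructor
  · rintro ⟨⟨h, hh, hc⟩, ⟨g, hg, hd⟩⟩
    refine ⟨Sum.elim h g, by rintro (j | j); exacts [hh j, hg j], fun c hc' => ?_⟩
    simp only [List.mem_append, List.mem_map] at hc'
    rcases hc' with ⟨a, ha, rfl⟩ | ⟨a, ha, rfl⟩
    · rw [EtrInv.sat_map, e₁]; exact hc a ha
    · rw [EtrInv.sat_map, e₂]; exact hd a ha
  · rintro ⟨h, hh, hc⟩
    refine ⟨⟨h ∘ Sum.inl, fun j => hh _, fun c hc' => ?_⟩,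
      ⟨h ∘ Sum.inr, fun j => hh _, fun c hc' => ?_⟩⟩
    · rw [← e₁, ← EtrInv.sat_map]
      exact hc _ (List.mem_append_left _ (List.mem_map_of_mem hc'))
    · rw [← e₂, ← EtrInv.sat_map]
      exact hc _ (List.mem_append_right _ (List.mem_map_of_mem hc'))

theorem mono (hR : InvDefinable s R) (hst : s ≤ t) : InvDefinable t R := by
  obtain ⟨u, rfl⟩ := Nat.exists_eq_add_of_le hst
  exact (hR.and (trivial W u)).congr fun w _ => by simp

theorem exists_var {R : (Option W → ℝ) → Prop} (hR : InvDefinable s R) :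
    InvDefinable s (fun w => ∃ x ∈ InvRange, R (fun o => o.elim x w)) := by
  obtain ⟨A, hA, L, rfl, H⟩ := hR
  let e : Option W ⊕ A → W ⊕ Option A :=
    Sum.elim (fun o => o.elim (Sum.inr none) Sum.inl) (fun a => Sum.inr (some a))
  have he : ∀ (w : W → ℝ) (h : Option A → ℝ), Sum.elim w h ∘ e =
      Sum.elim (fun o : Option W => o.elim (h none) w) (fun a => h (some a)) := fun w h => by
    ext x; rcases x with (_ | x) | x <;> rfl
  refine ⟨Option A, inferInstance, L.map (EtrInv.map e), by simp, fun w hw => ?_⟩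
  constructor
  · rintro ⟨x, hx, hRx⟩
    obtain ⟨h, hh, hc⟩ := (H _ (by rintro (_ | i); exacts [hx, hw i])).1 hRx
    refine ⟨fun o => o.elim x h, by rintro (_ | j); exacts [hx, hh j], fun c hc' => ?_⟩
    obtain ⟨a, ha, rfl⟩ := List.mem_map.1 hc'
    rw [EtrInv.sat_map, he]
    exact hc a ha
  · rintro ⟨h, hh, hc⟩
    refine ⟨h none, hh _, (H _ (by rintro (_ | i); exacts [hh _, hw i])).2
      ⟨fun a => h (some a), fun j => hh _, fun c hc' => ?_⟩⟩
    rw [← he, ← EtrInv.sat_map]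
    exact hc _ (List.mem_map_of_mem hc')

theorem add_eq_add (i j k l : W) :
    InvDefinable 2 (fun w => w i + w j = w k + w l ∧ w i + w j ≤ 2) := by
  refine ((add (some i) (some j) none).and (add (some k) (some l) none)).exists_var.congr
    fun w hw => ?_
  have h₁ := hw i
  have h₂ := hw j
  simp only [Set.mem_Icc, Option.elim] at *
  constructor
  · rintro ⟨x, hx, h, h'⟩
    exact ⟨by linarith, by linarith⟩
  · rintro ⟨h, h'⟩
    exact ⟨w i + w j, ⟨by linarith, h'⟩, rfl, h.symm⟩

theorem half (i : W) : InvDefinable 2 (fun w => w i = 1 / 2) := by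
  refine ((one none).and (add (some i) (some i) none)).exists_var.congr fun w hw => ?_
  simp only [Set.mem_Icc, Option.elim] at *
  constructor
  · rintro ⟨x, hx, h, h'⟩
    linarith
  · intro h
    exact ⟨1, by norm_num, rfl, by linarith⟩

theorem two (i : W) : InvDefinable 2 (fun w => w i = 2) := by
  refine ((one none).and (add none none (some i))).exists_var.congr fun w hw => ?_
  simp only [Set.mem_Icc, Option.elim] at *
  constructor
  · rintro ⟨x, hx, h, h'⟩
    linarith
  · intro h
    exact ⟨1, by norm_num, rfl, by linarith⟩

theorem three_quarters (i : W) : InvDefinable 5 (fun w => w i = 3 / 4) := by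
  refine (((one (some none)).and (half none)).and
    (add_eq_add (some none) none (some (some i)) (some (some i)))).exists_var.exists_var.congr
      fun w hw => ?_
  simp only [Set.mem_Icc, Option.elim] at *
  constructor
  · rintro ⟨x, hx, y, hy, ⟨h, h'⟩, h'', -⟩
    linarith
  · intro h
    exact ⟨1, by norm_num, 1 / 2, by norm_num, ⟨rfl, rfl⟩, by linarith, by norm_num⟩

/-- The range of the encodings `1/2 + v/4` of `v ∈ [1/2, 2]`. -/
theorem mem_encoded (i : W) : InvDefinable 7 (fun w => w i ∈ Set.Icc (5 / 8 : ℝ) 1) := by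
  refine ((three_quarters none).and
    (add_eq_add (some (some i)) (some (some i)) (some none) none
      |>.exists_var)).exists_var.congr fun w hw => ?_
  simp only [Set.mem_Icc, Option.elim] at *
  constructor
  · rintro ⟨x, hx, h, y, hy, h', h''⟩
    constructor <;> linarith
  · rintro ⟨h, h'⟩
    exact ⟨3 / 4, by norm_num, rfl, 2 * w i - 3 / 4, ⟨by linarith, by linarith⟩,
      by linarith, by linarith⟩

theorem half_pow (k : ℕ) (i h j : W) : InvDefinable (4 + 2 * k)
    (fun w => w h = 1 / 2 ∧ w i ≤ 3 / 2 ∧ w j - 1 / 2 = (w i - 1 / 2) / 2 ^ k) := by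
  induction k generalizing W with
  | zero =>
    refine ((half h).and (add_eq_add i h j h)).congr fun w hw => ?_
    constructor
    · rintro ⟨h₁, h₂, h₃⟩
      exact ⟨h₁, by linarith, by rw [pow_zero]; linarith⟩
    · rintro ⟨h₁, h₂, h₃⟩
      rw [pow_zero] at h₃
      exact ⟨h₁, by linarith, by linarith⟩
  | succ k ih =>
    refine ((ih (some i) (some h) none).and
      (add_eq_add none (some h) (some j) (some j))).exists_var.congr fun w hw => ?_
    have hi := hw i
    simp only [Set.mem_Icc, Option.elim, pow_succ, ← div_div] at *
    constructor
    · rintro ⟨x, hx, ⟨h₁, h₂, h₃⟩, h₄, h₅⟩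
      exact ⟨h₁, h₂, by rw [← h₃]; linarith⟩
    · rintro ⟨h₁, h₂, h₃⟩
      have h₄ : 0 ≤ (w i - 1 / 2) / 2 ^ k := div_nonneg (by linarith) (by positivity)
      have h₅ : (w i - 1 / 2) / 2 ^ k ≤ w i - 1 / 2 :=
        div_le_self (by linarith) (one_le_pow₀ (by norm_num))
      exact ⟨1 / 2 + (w i - 1 / 2) / 2 ^ k, ⟨by linarith, by linarith⟩,
        ⟨h₁, h₂, by ring⟩, by linarith, by linarith⟩

theorem inv_add_inv (i j k : W) : InvDefinable 4
    (fun w => (w i)⁻¹ + (w j)⁻¹ ≤ 2 ∧ ((w i)⁻¹ + (w j)⁻¹) * w k = 1) := by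
  refine ((((inv (some (some (some i))) (some (some none))).and
    (inv (some (some (some j))) (some none))).and
    (add (some (some none)) (some none) none)).and
    (inv none (some (some (some k))))).exists_var.exists_var.exists_var.congr fun w hw => ?_
  have bound : ∀ x : ℝ, x ∈ InvRange → x⁻¹ ∈ InvRange := fun x hx =>
    ⟨by rw [one_div]; exact inv_anti₀ (by linarith [hx.1]) hx.2,
      by simpa using inv_anti₀ (by norm_num) hx.1⟩
  have hi := bound _ (hw i)
  have hj := bound _ (hw j)
  have hi' : w i ≠ 0 := by linarith [(hw i).1]
  have hj' : w j ≠ 0 := by linarith [(hw j).1]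
  simp only [Option.elim] at *
  constructor
  · rintro ⟨x, hx, y, hy, z, hz, ⟨⟨h₁, h₂⟩, h₃⟩, h₄⟩
    rw [← eq_inv_of_mul_eq_one_right h₁, ← eq_inv_of_mul_eq_one_right h₂, h₃]
    exact ⟨hz.2, h₄⟩
  · rintro ⟨h, h'⟩
    exact ⟨_, hi, _, hj, _, ⟨by linarith [hi.1, hj.1], h⟩,
      ⟨⟨mul_inv_cancel₀ hi', mul_inv_cancel₀ hj'⟩, rfl⟩, h'⟩

theorem sq (i j : W) : InvDefinable 11
    (fun w => w i ≤ 3 / 2 ∧ w j = 3 / 4 - (w i - 1) ^ 2 / 3) := by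
  refine ((((((two (some (some (some (some none))))).and
    (half (some (some (some none))))).and
    (add (some (some (some (some (some i))))) (some (some none))
      (some (some (some (some none)))))).and
    (add (some (some (some (some (some i))))) (some (some (some none))) (some none))).and
    (add (some (some none)) (some (some (some none))) none)).and
    (inv_add_inv (some none) none (some (some (some (some (some j)))))))
    |>.exists_var.exists_var.exists_var.exists_var.exists_var.congr fun w hw => ?_
  have hi := hw i
  have key : ∀ x : ℝ, 1 / 2 ≤ x → x ≤ 3 / 2 →
      (x + 1 / 2)⁻¹ + (2 - x + 1 / 2)⁻¹ = (3 / 4 - (x - 1) ^ 2 / 3)⁻¹ := fun x h₁ h₂ => by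
    have a : x + 1 / 2 ≠ 0 := by linarith
    have b : 2 - x + 1 / 2 ≠ 0 := by linarith
    have c : 3 / 4 - (x - 1) ^ 2 / 3 ≠ 0 := by nlinarith
    rw [_root_.inv_add_inv a b, inv_eq_one_div (3 / 4 - _), div_eq_div_iff (mul_ne_zero a b) c]
    ring
  simp only [Set.mem_Icc, Option.elim] at *
  constructor
  · rintro ⟨x, hx, y, hy, z, hz, u, hu, v, hv, ⟨⟨⟨⟨rfl, rfl⟩, h₃⟩, h₄⟩, h₅⟩, h₆, h₇⟩
    have h₈ : w i ≤ 3 / 2 := by linarith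
    obtain rfl : z = 2 - w i := by linarith
    rw [← h₄, ← h₅, key _ hi.1 h₈] at h₇
    exact ⟨h₈, by simpa using eq_inv_of_mul_eq_one_right h₇⟩
  · rintro ⟨h, h'⟩
    refine ⟨2, by norm_num, 1 / 2, by norm_num, 2 - w i, ⟨by linarith, by linarith⟩,
      w i + 1 / 2, ⟨by linarith, by linarith⟩, 2 - w i + 1 / 2, ⟨by linarith, by linarith⟩,
      ⟨⟨⟨⟨rfl, rfl⟩, by ring⟩, rfl⟩, rfl⟩, ?_⟩
    have h₁ : 1 / 2 ≤ w j := (hw j).1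
    rw [key _ hi.1 h, ← h']
    exact ⟨by simpa using inv_anti₀ (by norm_num) h₁, inv_mul_cancel₀ (by linarith)⟩

theorem sq_add (i j p : W) : InvDefinable 30 (fun w =>
    (w i ∈ Set.Icc (5 / 8 : ℝ) 1 ∧ w j ∈ Set.Icc (5 / 8 : ℝ) 1) ∧
      w p = 3 / 4 - (w i + w j - 1) ^ 2 / 12) := by
  refine (((mem_encoded i).and (mem_encoded j)).and
    ((((half (some (some none))).and
      (add_eq_add (some (some (some i))) (some (some (some j))) (some none) (some none))).and
      (add (some none) (some (some none)) none)).and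
      (sq none (some (some (some p)))) |>.exists_var.exists_var.exists_var)).congr fun w hw => ?_
  simp only [Set.mem_Icc, Option.elim] at *
  refine and_congr_right ?_
  rintro ⟨hi, hj⟩
  constructor
  · rintro ⟨x, hx, y, hy, z, hz, ⟨⟨h₁, h₂, h₃⟩, h₄⟩, h₅, h₆⟩
    obtain rfl : z = 1 + (w i + w j - 1) / 2 := by linarith
    rw [h₆]
    ring
  · intro h
    exact ⟨1 / 2, by norm_num, (w i + w j) / 2, ⟨by linarith, by linarith⟩,
      (w i + w j) / 2 + 1 / 2, ⟨by linarith, by linarith⟩,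
      ⟨⟨rfl, by ring, by linarith⟩, rfl⟩, by linarith, by rw [h]; ring⟩

theorem sq_sub (i j p : W) : InvDefinable 34 (fun w =>
    (w i ∈ Set.Icc (5 / 8 : ℝ) 1 ∧ w j ∈ Set.Icc (5 / 8 : ℝ) 1) ∧
      w p = 3 / 4 - (w i - w j) ^ 2 / 12) := by
  refine (((mem_encoded i).and (mem_encoded j)).and
    ((((((half (some (some (some (some none))))).and (one (some (some (some none))))).and
      (add_eq_add (some (some (some (some (some i))))) (some (some (some (some none))))
        (some (some none)) (some (some none)))).and
      (add_eq_add (some (some (some (some (some j))))) (some (some (some (some none))))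
        (some none) (some none))).and
      (add_eq_add (some (some none)) (some (some (some none))) (some none) none)).and
      (sq none (some (some (some (some (some p))))))
      |>.exists_var.exists_var.exists_var.exists_var.exists_var)).congr fun w hw => ?_
  simp only [Set.mem_Icc, Option.elim] at *
  refine and_congr_right ?_
  rintro ⟨hi, hj⟩
  constructor
  · rintro ⟨x, hx, y, hy, u, hu, v, hv, z, hz,
      ⟨⟨⟨⟨h₁, h₂⟩, h₃, h₃'⟩, h₄, h₄'⟩, h₅, h₅'⟩, h₆, h₇⟩
    obtain rfl : z = 1 + (w i - w j) / 2 := by linarith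
    rw [h₇]
    ring
  · intro h
    exact ⟨1 / 2, by norm_num, 1, by norm_num,
      (w i + 1 / 2) / 2, ⟨by linarith, by linarith⟩,
      (w j + 1 / 2) / 2, ⟨by linarith, by linarith⟩,
      1 + (w i - w j) / 2, ⟨by linarith, by linarith⟩,
      ⟨⟨⟨⟨rfl, rfl⟩, by ring, by linarith⟩, by ring, by linarith⟩, by ring, by linarith⟩,
      by linarith, by rw [h]; ring⟩

theorem mul_eq_mul (i j k l : W) : InvDefinable 130 (fun w =>
    ((w i ∈ Set.Icc (5 / 8 : ℝ) 1 ∧ w j ∈ Set.Icc (5 / 8 : ℝ) 1) ∧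
      w k ∈ Set.Icc (5 / 8 : ℝ) 1 ∧ w l ∈ Set.Icc (5 / 8 : ℝ) 1) ∧
      (2 * w i - 1) * (2 * w j - 1) = (2 * w k - 1) * (2 * w l - 1)) := by
  refine (((((sq_add (some (some (some (some i)))) (some (some (some (some j))))
      (some (some (some none)))).and
    (sq_sub (some (some (some (some i)))) (some (some (some (some j))))
      (some (some none)))).and
    (sq_add (some (some (some (some k)))) (some (some (some (some l))))
      (some none))).and
    (sq_sub (some (some (some (some k)))) (some (some (some (some l))))
      none)).and
    (add_eq_add (some (some none)) (some none) (some (some (some none))) none))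
    |>.exists_var.exists_var.exists_var.exists_var.congr fun w hw => ?_
  simp only [Set.mem_Icc, Option.elim] at *
  constructor
  · rintro ⟨x, hx, y, hy, u, hu, v, hv,
      ⟨⟨⟨⟨h₁, rfl⟩, -, rfl⟩, h₂, rfl⟩, -, rfl⟩, h₃, -⟩
    exact ⟨⟨h₁, h₂⟩, by linarith⟩
  · rintro ⟨⟨h₁, h₂⟩, h₃⟩
    have bound_add : ∀ x y : ℝ, (5 / 8 ≤ x ∧ x ≤ 1) ∧ 5 / 8 ≤ y ∧ y ≤ 1 →
        1 / 2 ≤ 3 / 4 - (x + y - 1) ^ 2 / 12 ∧ 3 / 4 - (x + y - 1) ^ 2 / 12 ≤ 3 / 4 :=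
      fun x y h => ⟨by nlinarith, by nlinarith⟩
    have bound_sub : ∀ x y : ℝ, (5 / 8 ≤ x ∧ x ≤ 1) ∧ 5 / 8 ≤ y ∧ y ≤ 1 →
        1 / 2 ≤ 3 / 4 - (x - y) ^ 2 / 12 ∧ 3 / 4 - (x - y) ^ 2 / 12 ≤ 3 / 4 :=
      fun x y h => ⟨by nlinarith, by nlinarith⟩
    have a₁ := bound_add _ _ h₁
    have a₂ := bound_sub _ _ h₁
    have a₃ := bound_add _ _ h₂
    have a₄ := bound_sub _ _ h₂
    exact ⟨_, ⟨a₁.1, by linarith⟩, _, ⟨a₂.1, by linarith⟩, _, ⟨a₃.1, by linarith⟩,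
      _, ⟨a₄.1, by linarith⟩, ⟨⟨⟨⟨h₁, rfl⟩, h₁, rfl⟩, h₂, rfl⟩, h₂, rfl⟩,
      by linarith, by linarith⟩

end InvDefinable

/-- The value in `[1/2, 2]` encoded by `x`: the clamped inverse of `v ↦ 1/2 + v/4`. -/
noncomputable def decodeInv (x : ℝ) : ℝ := max (1 / 2) (min 2 (4 * x - 2))

theorem decodeInv_mem_range (x : ℝ) : decodeInv x ∈ InvRange :=
  ⟨le_max_left _ _, max_le (by norm_num) (min_le_left _ _)⟩

theorem decodeInv_mem {K : Subfield ℝ} {x : ℝ} (hx : x ∈ K) : decodeInv x ∈ K := by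
  have h2 : (2 : ℝ) ∈ K := ofNat_mem K 2
  have h4 : (4 : ℝ) ∈ K := ofNat_mem K 4
  rw [decodeInv]
  rcases max_choice (1 / 2 : ℝ) (min 2 (4 * x - 2)) with h | h <;> rw [h]
  · exact div_mem (one_mem K) h2
  · rcases min_choice (2 : ℝ) (4 * x - 2) with h | h <;> rw [h]
    · exact h2
    · exact sub_mem (mul_mem h4 hx) h2

theorem decodeInv_of_mem {x : ℝ} (hx : x ∈ Set.Icc (5 / 8 : ℝ) 1) : decodeInv x = 4 * x - 2 := by
  rw [decodeInv, min_eq_right (by linarith [hx.2]), max_eq_right (by linarith [hx.1])]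

open InvDefinable in
/-- Every ETR-C(q) constraint is definable on the encoded variables. -/
theorem EtrC.exists_invDefinable (k : ℕ) {V : Type} (c : EtrC V) :
    ∃ R : (V → ℝ) → Prop, InvDefinable (1266 + 2 * k) R ∧
      (∀ w, R w → c.Sat ((2 : ℝ) ^ (-(k : ℤ))) (fun v => decodeInv (w v))) ∧
      ∀ f : V → ℝ, (∀ v, f v ∈ InvRange) → c.Sat ((2 : ℝ) ^ (-(k : ℤ))) f →
        R (fun v => 1 / 2 + f v / 4) := by
  have enc : ∀ y : ℝ, y ∈ InvRange → 1 / 2 + y / 4 ∈ Set.Icc (5 / 8 : ℝ) 1 := fun y hy =>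
    ⟨by linarith [hy.1], by linarith [hy.2]⟩
  cases c with
  | eq x y =>
    refine ⟨_, ((((mem_encoded x).and (mem_encoded y)).and
      (add_eq_add x x x y)).mono (by omega)), ?_, ?_⟩
    · rintro w ⟨⟨hx, hy⟩, h, -⟩
      simp only [EtrC.Sat, decodeInv_of_mem hx, decodeInv_of_mem hy]
      linarith
    · intro f hf h
      have ex := enc _ (hf x)
      have ey := enc _ (hf y)
      simp only [EtrC.Sat] at h
      exact ⟨⟨ex, ey⟩, by linarith, by linarith [ex.2]⟩
  | eqQ x y =>
    refine ⟨_, ((((mem_encoded x).and (mem_encoded y)).and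
      ((half_pow k (some (some y)) (some none) none).and
        (add_eq_add (some (some x)) (some none) (some (some y)) none)
        |>.exists_var.exists_var)).mono (by omega)), ?_, ?_⟩
    · rintro w ⟨⟨hx, hy⟩, a, ha, b, hb, ⟨h₁, h₂, h₃⟩, h₄, h₅⟩
      simp only [Option.elim] at *
      simp only [EtrC.Sat, decodeInv_of_mem hx, decodeInv_of_mem hy, zpow_neg, zpow_natCast]
      rw [div_eq_mul_inv (w y - 1 / 2)] at h₃
      linarith
    · intro f hf h
      have ex := enc _ (hf x)
      have ey := enc _ (hf y)
      simp only [EtrC.Sat, zpow_neg, zpow_natCast] at h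
      have h₀ := (hf y).1
      have h₁ : 0 ≤ (f y / 4) / 2 ^ k := div_nonneg (by linarith) (by positivity)
      have h₂ : (f y / 4) / 2 ^ k ≤ f y / 4 :=
        div_le_self (by linarith) (one_le_pow₀ (by norm_num))
      refine ⟨⟨ex, ey⟩, 1 / 2, by norm_num, 1 / 2 + (f y / 4) / 2 ^ k,
        ⟨by linarith, by linarith [ey.2]⟩, ⟨rfl, ?_, ?_⟩, ?_, ?_⟩ <;> simp only [Option.elim]
      · linarith [ey.2]
      · ring
      · rw [h]; ring
      · linarith [ex.2]
  | add x y z =>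
    refine ⟨_, (((((mem_encoded x).and (mem_encoded y)).and (mem_encoded z)).and
      ((half none).and (add_eq_add (some x) (some y) (some z) none)
        |>.exists_var)).mono (by omega)), ?_, ?_⟩
    · rintro w ⟨⟨⟨hx, hy⟩, hz⟩, a, ha, h₁, h₂, h₃⟩
      simp only [Option.elim] at *
      simp only [EtrC.Sat, decodeInv_of_mem hx, decodeInv_of_mem hy, decodeInv_of_mem hz]
      linarith
    · intro f hf h
      have ex := enc _ (hf x)
      have ey := enc _ (hf y)
      simp only [EtrC.Sat] at h
      refine ⟨⟨⟨ex, ey⟩, enc _ (hf z)⟩, 1 / 2, by norm_num, rfl, ?_, ?_⟩ <;>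
        simp only [Option.elim]
      · linarith
      · linarith [ex.2, ey.2]
  | add4 x y z t =>
    refine ⟨_, ((((mem_encoded x).and (mem_encoded y)).and
      ((mem_encoded z).and (mem_encoded t))).and (add_eq_add x y z t)).mono (by omega), ?_, ?_⟩
    · rintro w ⟨⟨⟨hx, hy⟩, hz, ht⟩, h, -⟩
      simp only [EtrC.Sat, decodeInv_of_mem hx, decodeInv_of_mem hy, decodeInv_of_mem hz,
        decodeInv_of_mem ht]
      linarith
    · intro f hf h
      have ex := enc _ (hf x)
      have ey := enc _ (hf y)
      simp only [EtrC.Sat] at h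
      exact ⟨⟨⟨ex, ey⟩, enc _ (hf z), enc _ (hf t)⟩, by linarith, by linarith [ex.2, ey.2]⟩
  | mul x y z =>
    refine ⟨_, ((three_quarters none).and (mul_eq_mul (some x) (some y) (some z) none)
        |>.exists_var).mono (by omega), ?_, ?_⟩
    · rintro w ⟨a, ha, h, ⟨⟨hx, hy⟩, hz, -⟩, h'⟩
      simp only [Option.elim] at *
      simp only [EtrC.Sat, decodeInv_of_mem hx, decodeInv_of_mem hy, decodeInv_of_mem hz]
      rw [h] at h'
      linarith
    · intro f hf h
      simp only [EtrC.Sat] at h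
      refine ⟨3 / 4, by norm_num, rfl, ⟨⟨enc _ (hf x), enc _ (hf y)⟩, enc _ (hf z),
        by norm_num⟩, ?_⟩
      simp only [Option.elim]
      linarith
  | mul4 x y z t =>
    refine ⟨_, (mul_eq_mul x y z t).mono (by omega), ?_, ?_⟩
    · rintro w ⟨⟨⟨hx, hy⟩, hz, ht⟩, h⟩
      simp only [EtrC.Sat, decodeInv_of_mem hx, decodeInv_of_mem hy, decodeInv_of_mem hz,
        decodeInv_of_mem ht]
      linarith
    · intro f hf h
      simp only [EtrC.Sat] at h
      exact ⟨⟨⟨enc _ (hf x), enc _ (hf y)⟩, enc _ (hf z), enc _ (hf t)⟩, by linarith⟩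

theorem Multiset.card_filter_finset_sum {ι α : Type*} (s : Finset ι) (m : ι → Multiset α)
    (p : α → Prop) [DecidablePred p] :
    ((∑ i ∈ s, m i).filter p).card = ∑ i ∈ s, ((m i).filter p).card := by
  simp only [← Multiset.countP_eq_card_filter, ← Multiset.coe_countPAddMonoidHom, map_sum]

theorem Multiset.card_filter_eq_sum {α : Type*} (m : Multiset α) (p : α → Prop) [DecidablePred p] :
    (m.filter p).card = ∑ x : m, if p x.1 then 1 else 0 := by
  rw [Finset.sum_boole, ← Multiset.countP_eq_card_filter]
  conv_lhs => rw [← Multiset.map_univ_coe m]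
  rw [Multiset.countP_map]
  rfl

/-- An ETR-C(q) instance reduces to an ETR-INV instance with exactly `1266 + 2k` constraints per
original constraint; the numbers of unsatisfied constraints are compared pointwise. -/
theorem exists_etrInv_instance (k : ℕ) {n : ℕ} (φ : Multiset (EtrC (Fin n))) :
    ∃ (m : ℕ) (e : Fin n → Fin m) (ψ : Multiset (EtrInv (Fin m))),
      ψ.card = (1266 + 2 * k) * φ.card ∧
      (∀ g : Fin m → ℝ, (∀ v, g v ∈ InvRange) →
        (φ.filter (fun c => ¬ EtrC.Sat ((2 : ℝ) ^ (-(k : ℤ)))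
          (fun v => decodeInv (g (e v))) c)).card ≤
          (ψ.filter (fun c => ¬ EtrInv.Sat g c)).card) ∧
      ∀ f : Fin n → ℝ, (∀ v, f v ∈ InvRange) → ∃ g : Fin m → ℝ, (∀ v, g v ∈ InvRange) ∧
        (ψ.filter (fun c => ¬ EtrInv.Sat g c)).card ≤ (1266 + 2 * k) *
          (φ.filter (fun c => ¬ EtrC.Sat ((2 : ℝ) ^ (-(k : ℤ))) f c)).card := by
  choose R hdef hsound hcomplete using fun c : EtrC (Fin n) => c.exists_invDefinable k
  choose A hA L hL H using hdef
  obtain ⟨m, ⟨E⟩⟩ := Finite.exists_equiv_fin (Fin n ⊕ (Σ i : φ, A i.1))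
  let emb (i : φ) : Fin n ⊕ A i.1 → Fin m := fun x => E (Sum.map id (Sigma.mk i) x)
  have hemb : ∀ (i : φ) (g : Fin m → ℝ), g ∘ emb i =
      Sum.elim (fun v => g (E (Sum.inl v))) (fun a => g (E (Sum.inr ⟨i, a⟩))) := fun i g => by
    ext x; cases x <;> rfl
  refine ⟨m, fun v => E (Sum.inl v),
    ∑ i : φ, (((L i.1).map (EtrInv.map (emb i)) : List _) : Multiset (EtrInv (Fin m))), ?_, ?_, ?_⟩
  · simp [Multiset.card_sum, hL, mul_comm]
  · intro g hg
    rw [Multiset.card_filter_finset_sum, Multiset.card_filter_eq_sum]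
    refine Finset.sum_le_sum fun i _ => ?_
    split_ifs with h
    · exact Nat.zero_le _
    · rw [Nat.one_le_iff_ne_zero, Ne, Multiset.card_eq_zero, Multiset.filter_eq_nil]
      intro hall
      refine h (hsound i.1 _ ((H i.1 (fun v => g (E (Sum.inl v))) fun v => hg _).2
        ⟨fun a => g (E (Sum.inr ⟨i, a⟩)), fun a => hg _, fun c hc => ?_⟩))
      rw [← hemb, ← EtrInv.sat_map]
      exact not_not.1 (hall _ (Multiset.mem_coe.2 (List.mem_map_of_mem hc)))
  · intro f hf
    have enc : ∀ v, 1 / 2 + f v / 4 ∈ InvRange := fun v =>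
      ⟨by linarith [(hf v).1], by linarith [(hf v).2]⟩
    have aux : ∀ i : φ, ∃ h : A i.1 → ℝ, (∀ a, h a ∈ InvRange) ∧
        (EtrC.Sat ((2 : ℝ) ^ (-(k : ℤ))) f i.1 →
          ∀ c ∈ L i.1, c.Sat (Sum.elim (fun v => 1 / 2 + f v / 4) h)) := fun i => by
      by_cases hi : EtrC.Sat ((2 : ℝ) ^ (-(k : ℤ))) f i.1
      · obtain ⟨h, hh, hc⟩ := (H i.1 _ enc).1 (hcomplete i.1 f hf hi)
        exact ⟨h, hh, fun _ => hc⟩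
      · exact ⟨fun _ => 1, fun _ => by norm_num [InvRange], fun h => absurd h hi⟩
    choose h hh hc using aux
    let g' : Fin n ⊕ (Σ i : φ, A i.1) → ℝ :=
      Sum.elim (fun v => 1 / 2 + f v / 4) (fun a => h a.1 a.2)
    have hg' : ∀ x, g' x ∈ InvRange := by
      rintro (v | a)
      exacts [enc v, hh _ _]
    refine ⟨fun v => g' (E.symm v), fun v => hg' _, ?_⟩
    rw [Multiset.card_filter_finset_sum, Multiset.card_filter_eq_sum, Finset.mul_sum]
    refine Finset.sum_le_sum fun i _ => ?_
    split_ifs with hi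
    · rw [Nat.mul_zero, Nat.le_zero, Multiset.card_eq_zero, Multiset.filter_eq_nil]
      intro c hc'
      obtain ⟨b, hb, rfl⟩ := List.mem_map.1 (Multiset.mem_coe.1 hc')
      rw [not_not, EtrInv.sat_map, hemb]
      simpa [g'] using hc i hi b hb
    · refine (Multiset.card_le_card (Multiset.filter_le _ _)).trans ?_
      simp [hL]

/-- for `q = 2^(−k)` with `k ≥ 6`, every nonempty ETR-C(q) instance `φ`
admits a nonempty ETR-INV instance `ψ` with `UNSAT(ψ) ≤ UNSAT(φ)` and, for every
`d ∈ ℕ`, `(1266 + 2k)⁻¹·UNSAT_d(φ) ≤ UNSAT_d(ψ)`. -/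
theorem gap_preserving_reduction_low_degree (k : ℕ) (hk : 6 ≤ k)
    {n : ℕ} (φ : Multiset (EtrC (Fin n))) (hφ : φ ≠ 0) :
    ∃ (m : ℕ) (ψ : Multiset (EtrInv (Fin m))), ψ ≠ 0 ∧
      unsatInv ψ ≤ unsatC ((2 : ℝ) ^ (-(k : ℤ))) φ ∧
      ∀ d : ℕ, ((1266 + 2 * k : ℝ))⁻¹ * unsatCD ((2 : ℝ) ^ (-(k : ℤ))) d φ ≤
        unsatInvD d ψ := by
  obtain ⟨m, e, ψ, hcard, hsound, hcomplete⟩ := exists_etrInv_instance k φ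
  have hpos : 0 < φ.card := Multiset.card_pos.2 hφ
  have hS : (0 : ℝ) < 1266 + 2 * k := by positivity
  have hN : (0 : ℝ) < φ.card := by exact_mod_cast hpos
  have hcard' : (ψ.card : ℝ) = (1266 + 2 * k) * φ.card := by rw [hcard]; push_cast; ring
  refine ⟨m, ψ, Multiset.card_pos.1 (by rw [hcard]; positivity), ?_, fun d => ?_⟩
  · rw [unsatInv, unsatC]
    refine le_csInf ⟨_, fun _ => 1, fun _ => by norm_num, rfl⟩ ?_
    rintro _ ⟨f, hf, rfl⟩
    obtain ⟨g, hg, hle⟩ := hcomplete f hf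
    refine csInf_le_of_le ⟨0, ?_⟩ ⟨g, hg, rfl⟩ ?_
    · rintro _ ⟨_, _, rfl⟩
      positivity
    · rw [hcard', div_le_div_iff₀ (by positivity) hN]
      have hle' : ((ψ.filter (fun c => ¬ EtrInv.Sat g c)).card : ℝ) ≤ (1266 + 2 * k) *
          (φ.filter (fun c => ¬ EtrC.Sat ((2 : ℝ) ^ (-(k : ℤ))) f c)).card := by
        exact_mod_cast hle
      calc _ ≤ _ := mul_le_mul_of_nonneg_right hle' hN.le
        _ = _ := by ring
  · rw [unsatInvD, unsatCD]
    refine le_csInf ⟨_, fun _ => 1, fun _ => ⟨by norm_num, one_mem _⟩, rfl⟩ ?_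
    rintro _ ⟨g, hg, rfl⟩
    rw [inv_mul_le_iff₀ hS]
    refine csInf_le_of_le ⟨0, ?_⟩ ⟨fun v => decodeInv (g (e v)),
      fun v => ⟨decodeInv_mem_range _, decodeInv_mem (hg _).2⟩, rfl⟩ ?_
    · rintro _ ⟨_, _, rfl⟩
      positivity
    · rw [hcard', ← mul_div_assoc, mul_div_mul_left _ _ hS.ne']
      gcongr
      exact hsound g fun v => (hg v).1
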